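/- Let S be a Cu-semigroup satisfying (O8), let w ∈ S satisfy 2w = w, let n ≥ 1, and let x₁', …, xₙ', x₁, …, xₙ, z ∈ S satisfy x₁ + … + xₙ ≪ z + w and x_j' ≪ x_j for j = 1, …, n. Then there exist z₁, …, zₙ ∈ S such that z₁ + … + zₙ ≪ z, x_j' ≪ z_j + w, and z_j ≪ x_j + w for j = 1, …, n. -/

import Mathlib

variable {S : Type*} [AddCommMonoid S] [PartialOrder S]

/-- The (sequential) way-below relation: `x ≪ y` if for every increasing sequence whose
supremum dominates `y`, some member of the sequence dominates `x`. -/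
def WayBelow (x y : S) : Prop :=
  ∀ f : ℕ → S, Monotone f → ∀ s : S, IsLUB (Set.range f) s → y ≤ s → ∃ n, x ≤ f n

/-- A Cu-semigroup (abstract Cuntz semigroup): a positively ordered commutative monoid
satisfying the axioms (O1)-(O4). -/
structure IsCuSemigroup (S : Type*) [AddCommMonoid S] [PartialOrder S] : Prop where
  zero_le : ∀ x : S, 0 ≤ x
  add_le_add : ∀ {a b c d : S}, a ≤ b → c ≤ d → a + c ≤ b + d
  O1 : ∀ f : ℕ → S, Monotone f → ∃ s : S, IsLUB (Set.range f) s
  O2 : ∀ x : S, ∃ f : ℕ → S, (∀ n, WayBelow (f n) (f (n + 1))) ∧ IsLUB (Set.range f) x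
  O3 : ∀ {x' x y' y : S}, WayBelow x' x → WayBelow y' y → WayBelow (x' + y') (x + y)
  O4 : ∀ f g : ℕ → S, Monotone f → Monotone g → ∀ s t : S, IsLUB (Set.range f) s →
    IsLUB (Set.range g) t → IsLUB (Set.range fun n => f n + g n) (s + t)

/-- Axiom (O5) for Cu-semigroups. -/
def AxiomO5 (S : Type*) [AddCommMonoid S] [PartialOrder S] : Prop :=
  ∀ x' x y' y z : S, x + y ≤ z → WayBelow x' x → WayBelow y' y →
    ∃ c : S, x' + c ≤ z ∧ z ≤ x + c ∧ WayBelow y' c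

/-- Axiom (O6) for Cu-semigroups. -/
def AxiomO6 (S : Type*) [AddCommMonoid S] [PartialOrder S] : Prop :=
  ∀ x' x y z : S, WayBelow x' x → x ≤ y + z →
    ∃ e f : S, x' ≤ e + f ∧ e ≤ x ∧ e ≤ y ∧ f ≤ x ∧ f ≤ z

/-- Axiom (O8) for Cu-semigroups. -/
def AxiomO8 (S : Type*) [AddCommMonoid S] [PartialOrder S] : Prop :=
  ∀ x' x y' y z w : S, 2 • w = w → WayBelow (x + y) (z + w) → WayBelow x' x → WayBelow y' y →
    ∃ z₁ z₂ : S, WayBelow (z₁ + z₂) z ∧ WayBelow x' (z₁ + w) ∧ WayBelow y' (z₂ + w) ∧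
      WayBelow z₁ (x + w) ∧ WayBelow z₂ (y + w)

/-- A Cu-semigroup is weakly cancellative if `x + z ≪ y + z` implies `x ≪ y`. -/
def WeaklyCancellative (S : Type*) [AddCommMonoid S] [PartialOrder S] : Prop :=
  ∀ x y z : S, WayBelow (x + z) (y + z) → WayBelow x y

/-- An element `x` is weakly `(k,ω)`-divisible. -/
def IsWeaklyDivisible (k : ℕ) (x : S) : Prop :=
  ∀ x' : S, WayBelow x' x → ∃ (n : ℕ) (y : Fin n → S),
    (∀ j, k • y j ≤ x) ∧ x' ≤ ∑ j, y j

/-- An element `x` is `(k,ω)`-divisible. -/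
def IsDivisible (k : ℕ) (x : S) : Prop :=
  ∀ x' : S, WayBelow x' x → ∃ (n : ℕ) (y : S), k • y ≤ x ∧ x' ≤ n • y

/-- The interval axiom for Cu-semigroups. -/
def IntervalAxiom (S : Type*) [AddCommMonoid S] [PartialOrder S] : Prop :=
  ∀ x' x y u v : S, WayBelow x' x → WayBelow x (y + u) → WayBelow x (y + v) →
    ∃ w : S, WayBelow x' (y + w) ∧ WayBelow w u ∧ WayBelow w v

/-- The Riesz Interpolation Property. -/
def RieszInterpolation (S : Type*) [AddCommMonoid S] [PartialOrder S] : Prop :=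
  ∀ x₁ x₂ y₁ y₂ : S, x₁ ≤ y₁ → x₁ ≤ y₂ → x₂ ≤ y₁ → x₂ ≤ y₂ →
    ∃ z : S, x₁ ≤ z ∧ x₂ ≤ z ∧ z ≤ y₁ ∧ z ≤ y₂

/-- A Cu-semigroup is countably based if there is a countable subset such that every
element is the supremum of an increasing sequence from that subset. -/
def CountablyBased (S : Type*) [AddCommMonoid S] [PartialOrder S] : Prop :=
  ∃ B : Set S, B.Countable ∧ ∀ x : S, ∃ f : ℕ → S,
    Monotone f ∧ (∀ n, f n ∈ B) ∧ IsLUB (Set.range f) x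

/-- A Cu-semigroup is inf-semilattice ordered if finite infima exist and addition
distributes over them. -/
def InfSemilatticeOrdered (S : Type*) [AddCommMonoid S] [PartialOrder S] : Prop :=
  (∀ x y : S, ∃ m : S, IsGLB {x, y} m) ∧
    ∀ x y z m : S, IsGLB {x, y} m → IsGLB {x + z, y + z} (m + z)

namespace WayBelow

theorem le {α : Type*} [PartialOrder α] {x y : α} (h : WayBelow x y) : x ≤ y := by
  obtain ⟨_, hn⟩ := h (fun _ => y) monotone_const y (by simp) le_rfl
  exact hn

theorem trans_le {α : Type*} [PartialOrder α] {x y z : α} (h : WayBelow x y) (hyz : y ≤ z) :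
    WayBelow x z :=
  fun f hf s hs hz => h f hf s hs (hyz.trans hz)

end WayBelow

theorem LE.le.trans_wayBelow {α : Type*} [PartialOrder α] {x y z : α}
    (hxy : x ≤ y) (h : WayBelow y z) :
    WayBelow x z :=
  fun f hf s hs hz => (h f hf s hs hz).imp fun _ hn => hxy.trans hn

namespace IsCuSemigroup

theorem zero_wayBelow (hS : IsCuSemigroup S) (x : S) : WayBelow 0 x :=
  fun f _ _ _ _ => ⟨0, hS.zero_le (f 0)⟩

theorem exists_between (hS : IsCuSemigroup S) {x y : S} (h : WayBelow x y) :
    ∃ u, WayBelow x u ∧ WayBelow u y := by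
  obtain ⟨f, hf, hy⟩ := hS.O2 y
  obtain ⟨n, hn⟩ := h f (monotone_nat_of_le_succ fun n => (hf n).le) y hy le_rfl
  exact ⟨f (n + 1), hn.trans_wayBelow (hf n),
    (hf (n + 1)).trans_le (hy.1 (Set.mem_range_self _))⟩

theorem sum_wayBelow_sum (hS : IsCuSemigroup S) {ι : Type*} (s : Finset ι) {x y : ι → S}
    (h : ∀ j ∈ s, WayBelow (x j) (y j)) : WayBelow (∑ j ∈ s, x j) (∑ j ∈ s, y j) := by
  classical
  induction s using Finset.induction_on with
  | empty => simpa using hS.zero_wayBelow 0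
  | insert a s ha ih =>
    rw [Finset.sum_insert ha, Finset.sum_insert ha]
    exact hS.O3 (h a (s.mem_insert_self a)) (ih fun j hj => h j (Finset.mem_insert_of_mem hj))

end IsCuSemigroup

theorem axiomO8_multiple (S : Type*) [AddCommMonoid S] [PartialOrder S]
    (hS : IsCuSemigroup S) (h8 : AxiomO8 S) (w : S) (hw : 2 • w = w)
    (n : ℕ) (hn : 1 ≤ n) (x' x : Fin n → S) (z : S)
    (hsum : WayBelow (∑ j, x j) (z + w)) (hx : ∀ j, WayBelow (x' j) (x j)) :
    ∃ zs : Fin n → S, WayBelow (∑ j, zs j) z ∧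
      (∀ j, WayBelow (x' j) (zs j + w)) ∧ ∀ j, WayBelow (zs j) (x j + w) := by
  clear hn
  induction n generalizing z with
  | zero => exact ⟨fun _ => 0, by simpa using hS.zero_wayBelow z,
      fun j => j.elim0, fun j => j.elim0⟩
  | succ n ih =>
    choose u hxu hux using fun j => hS.exists_between (hx j)
    rw [Fin.sum_univ_succ] at hsum
    obtain ⟨z₀, v, hz, hxz₀, huv, hz₀x, -⟩ := h8 _ _ _ _ _ _ hw hsum (hx 0)
      (hS.sum_wayBelow_sum Finset.univ fun j _ => hux (Fin.succ j))
    obtain ⟨zs, hzs, hxzs, hzsu⟩ :=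
      ih (fun j => x' j.succ) (fun j => u j.succ) v huv fun j => hxu j.succ
    refine ⟨Fin.cons z₀ zs, ?_, Fin.cases hxz₀ hxzs, Fin.cases hz₀x fun j => ?_⟩
    · simpa [Fin.sum_univ_succ] using (hS.add_le_add le_rfl hzs.le).trans_wayBelow hz
    · exact (hzsu j).trans_le (hS.add_le_add (hux j.succ).le le_rfl)
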